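/- Let Λ* ⊆ (F⁺_d)^N be a factorial language. Then Λ* is sofic if and only if there exists m̄ ∈ ℤ₊^N such that A = A_n̄ for all n̄ ≥ m̄, where A is the C*-algebra of checkers and A_n̄ its finite-stage subalgebras. -/

import Mathlib

open scoped ENNReal

/-- The `N`-fold direct product of the free monoid on `d` generators,
with coordinatewise multiplication. -/
abbrev MWord (d N : ℕ) : Type := Fin N → FreeMonoid (Fin d)

/-- The element of `(F⁺_d)^N` whose `i`-th coordinate is the one-letter word `k`
and whose other coordinates are empty. -/
def delta (d N : ℕ) (i : Fin N) (k : Fin d) : MWord d N :=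
  fun j => if j = i then FreeMonoid.of k else 1

/-- `ν` is a factor of `μ` if `μ = w * ν * q` for some `w, q`. -/
def IsFactor {d N : ℕ} (ν μ : MWord d N) : Prop :=
  ∃ w q : MWord d N, μ = w * ν * q

/-- A factorial language in `(F⁺_d)^N`. -/
def IsFL {d N : ℕ} (Λ : Set (MWord d N)) : Prop :=
  (∀ i : Fin N, ∃ k : Fin d, delta d N i k ∈ Λ) ∧
  ∀ μ ∈ Λ, ∀ ν : MWord d N, IsFactor ν μ → ν ∈ Λ

/-- The multilength of a multiword. -/
def mlen {d N : ℕ} (μ : MWord d N) : Fin N → ℕ := fun i => (μ i).length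

/-- The support of a multiword. -/
def msupp {d N : ℕ} (μ : MWord d N) : Set (Fin N) := {i | μ i ≠ 1}

noncomputable section

/-- The Hilbert space `ℓ²(Λ*)`. -/
abbrev ell2 {d N : ℕ} (Λ : Set (MWord d N)) : Type := lp (fun _ : Λ => ℂ) 2

/-- The standard orthonormal basis vector `e_w̄` of `ℓ²(Λ*)`. -/
def evec {d N : ℕ} (Λ : Set (MWord d N)) (w : Λ) : ell2 Λ :=
  letI := Classical.decEq (↥Λ)
  lp.single 2 w 1

end

/-- The relation `∼_n̄` on a language: equality of left multipliers of multilength `≤ n̄`. -/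
def simRel {d N : ℕ} (Λ : Set (MWord d N)) (n : Fin N → ℕ) (μ ν : MWord d N) : Prop :=
  ∀ w : MWord d N, mlen w ≤ n → (w * μ ∈ Λ ↔ w * ν ∈ Λ)

/-- The relation `∼` on a language: equality of all left multipliers. -/
def simFull {d N : ℕ} (Λ : Set (MWord d N)) (μ ν : MWord d N) : Prop :=
  ∀ w : MWord d N, w * μ ∈ Λ ↔ w * ν ∈ Λ

noncomputable section

/-- The C*-algebra of checkers of a factorial language: the unital commutative C*-subalgebra
of `B(ℓ²(Λ*))` generated by the projections `T_μ̄* T_μ̄`, `μ̄ ∈ Λ*`. -/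
def checkers {d N : ℕ} (Λ : Set (MWord d N)) (T : MWord d N → (ell2 Λ →L[ℂ] ell2 Λ)) :
    StarSubalgebra ℂ (ell2 Λ →L[ℂ] ell2 Λ) :=
  (StarAlgebra.adjoin ℂ {x : ell2 Λ →L[ℂ] ell2 Λ | ∃ μ ∈ Λ, x = star (T μ) * T μ}).topologicalClosure

/-- The C*-subalgebra `A_n̄` of `B(ℓ²(Λ*))` generated by the projections `T_μ̄* T_μ̄` with
`μ̄ ∈ Λ*`, `|μ̄| ≤ n̄`. -/
def checkersLe {d N : ℕ} (Λ : Set (MWord d N)) (T : MWord d N → (ell2 Λ →L[ℂ] ell2 Λ))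
    (n : Fin N → ℕ) : StarSubalgebra ℂ (ell2 Λ →L[ℂ] ell2 Λ) :=
  (StarAlgebra.adjoin ℂ {x : ell2 Λ →L[ℂ] ell2 Λ |
    ∃ μ : MWord d N, μ ∈ Λ ∧ mlen μ ≤ n ∧ x = star (T μ) * T μ}).topologicalClosure

theorem finite_setOf_mlen_le {d N : ℕ} (n : Fin N → ℕ) : {μ : MWord d N | mlen μ ≤ n}.Finite := by
  have h : {μ : MWord d N | mlen μ ≤ n} =
      Set.pi Set.univ (fun i => {l : FreeMonoid (Fin d) | l.length ≤ n i}) := by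
    ext μ
    simp [mlen, Pi.le_def]
  rw [h]
  exact Set.Finite.pi fun i => List.finite_length_le (Fin d) (n i)

theorem IsFL.left_mem {d N : ℕ} {Λ : Set (MWord d N)} (hFL : IsFL Λ) {μ ν : MWord d N}
    (h : μ * ν ∈ Λ) : μ ∈ Λ :=
  hFL.2 _ h _ ⟨1, ν, by simp⟩

theorem inner_evec_left {d N : ℕ} (Λ : Set (MWord d N)) (w : Λ) (x : ell2 Λ) :
    inner ℂ (evec Λ w) x = x w := by
  let := Classical.decEq (↥Λ)
  exact (lp.inner_single_left (𝕜 := ℂ) w 1 x).trans (by simp)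

open Classical in
theorem evec_apply {d N : ℕ} (Λ : Set (MWord d N)) (w u : Λ) :
    evec Λ w u = if u = w then 1 else 0 := by
  let := Classical.decEq (↥Λ)
  refine (lp.single_apply (E := fun _ : Λ => ℂ) 2 w 1 u).trans ?_
  rw [Pi.single_apply]
  congr

theorem ext_evec {d N : ℕ} {Λ : Set (MWord d N)} {P Q : ell2 Λ →L[ℂ] ell2 Λ}
    (h : ∀ w : Λ, P (evec Λ w) = Q (evec Λ w)) : P = Q := by
  let := Classical.decEq (↥Λ)
  refine lp.ext_continuousLinearMap (by simp) fun w => ?_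
  ext1
  simpa [evec] using h w

open Classical in
theorem star_mul_self_evec {d N : ℕ} {Λ : Set (MWord d N)}
    {T : MWord d N → (ell2 Λ →L[ℂ] ell2 Λ)}
    (hT1 : ∀ (μ : MWord d N) (w : Λ) (h : μ * (w : MWord d N) ∈ Λ),
      T μ (evec Λ w) = evec Λ ⟨μ * (w : MWord d N), h⟩)
    (hT2 : ∀ (μ : MWord d N) (w : Λ), μ * (w : MWord d N) ∉ Λ → T μ (evec Λ w) = 0)
    (μ : MWord d N) (w : Λ) :
    (star (T μ) * T μ) (evec Λ w) =
      if μ * (w : MWord d N) ∈ Λ then evec Λ w else 0 := by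
  split_ifs with hw
  · ext u
    rw [← inner_evec_left, mul_apply_eq_comp, ContinuousLinearMap.star_eq_adjoint,
      ContinuousLinearMap.adjoint_inner_right, hT1 μ w hw, evec_apply]
    by_cases hu : μ * (u : MWord d N) ∈ Λ
    · rw [hT1 μ u hu, inner_evec_left, evec_apply]
      simp [Subtype.ext_iff]
    · rw [hT2 μ u hu, inner_zero_left, if_neg]
      rintro rfl
      exact hu hw
  · rw [mul_apply_eq_comp, hT2 μ w hw, map_zero]

open Classical in
/-- A diagonal `0`-`1` operator whose entry at `w` depends only on which elements of a finite
set `F` are left multipliers of `w` lies in any star subalgebra containing the diagonal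
projections attached to the elements of `F`. -/
theorem exists_diagonal_mem {d N : ℕ} {Λ : Set (MWord d N)}
    (S : StarSubalgebra ℂ (ell2 Λ →L[ℂ] ell2 Λ)) {F : Set (MWord d N)} (hF : F.Finite)
    (hS : ∀ ν ∈ F, ∃ P ∈ S, ∀ w : Λ,
      P (evec Λ w) = if ν * (w : MWord d N) ∈ Λ then evec Λ w else 0)
    (G : Set (MWord d N) → Prop) :
    ∃ Q ∈ S, ∀ w : Λ,
      Q (evec Λ w) = if G {ν | ν ∈ F ∧ ν * (w : MWord d N) ∈ Λ} then evec Λ w else 0 := by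
  induction F, hF using Set.Finite.induction_on generalizing G with
  | empty =>
    by_cases hG : G ∅
    · exact ⟨1, one_mem S, fun w => by simp [hG]⟩
    · exact ⟨0, zero_mem S, fun w => by simp [hG]⟩
  | @insert a F _ _ ih =>
    obtain ⟨P, hPS, hP⟩ := hS a (Set.mem_insert a F)
    have hS' := fun ν hν => hS ν (Set.mem_insert_of_mem a hν)
    obtain ⟨Q₁, hQ₁S, hQ₁⟩ := ih hS' (fun s => G (insert a s))
    obtain ⟨Q₂, hQ₂S, hQ₂⟩ := ih hS' G
    refine ⟨Q₁ * P + Q₂ * (1 - P),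
      add_mem (mul_mem hQ₁S hPS) (mul_mem hQ₂S (sub_mem (one_mem S) hPS)), fun w => ?_⟩
    by_cases ha : a * (w : MWord d N) ∈ Λ
    · have h : {ν | ν ∈ insert a F ∧ ν * (w : MWord d N) ∈ Λ} =
          insert a {ν | ν ∈ F ∧ ν * (w : MWord d N) ∈ Λ} := by
        ext ν
        by_cases hν : ν = a <;> simp_all
      rw [h]
      simp [hP, hQ₁, ha]
    · have h : {ν | ν ∈ insert a F ∧ ν * (w : MWord d N) ∈ Λ} =
          {ν | ν ∈ F ∧ ν * (w : MWord d N) ∈ Λ} := by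
        ext ν
        by_cases hν : ν = a <;> simp_all
      rw [h]
      simp [hP, hQ₂, ha]

theorem commute_rankOne_iff {d N : ℕ} {Λ : Set (MWord d N)} {P : ell2 Λ →L[ℂ] ell2 Λ}
    (hP : IsSelfAdjoint P) {v w : Λ} {a b : Prop} [Decidable a] [Decidable b]
    (hv : P (evec Λ v) = if a then evec Λ v else 0)
    (hw : P (evec Λ w) = if b then evec Λ w else 0) :
    InnerProductSpace.rankOne ℂ (evec Λ v) (evec Λ w) * P =
      P * InnerProductSpace.rankOne ℂ (evec Λ v) (evec Λ w) ↔ (a ↔ b) := by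
  have hP' : ContinuousLinearMap.adjoint P = P := hP
  rw [ContinuousLinearMap.mul_def, ContinuousLinearMap.mul_def,
    InnerProductSpace.rankOne_comp, InnerProductSpace.comp_rankOne, hP', hv, hw]
  have h0 : InnerProductSpace.rankOne ℂ (evec Λ v) (evec Λ w) ≠ 0 := by
    intro h
    have h1 := congrArg (fun x : ell2 Λ => x v) (DFunLike.congr_fun h (evec Λ w))
    rw [InnerProductSpace.rankOne_apply, inner_evec_left] at h1
    simp [evec_apply] at h1
  by_cases ha : a <;> by_cases hb : b <;> simp [ha, hb, h0, h0.symm]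

/-- Two words that no generator separates are separated by no element of the generated
C*-algebra. -/
theorem checkersLe_le_centralizer_rankOne {d N : ℕ} {Λ : Set (MWord d N)}
    {T : MWord d N → (ell2 Λ →L[ℂ] ell2 Λ)}
    (hT1 : ∀ (μ : MWord d N) (w : Λ) (h : μ * (w : MWord d N) ∈ Λ),
      T μ (evec Λ w) = evec Λ ⟨μ * (w : MWord d N), h⟩)
    (hT2 : ∀ (μ : MWord d N) (w : Λ), μ * (w : MWord d N) ∉ Λ → T μ (evec Λ w) = 0)
    {n : Fin N → ℕ} {v w : Λ} (h : simRel Λ n v w) :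
    checkersLe Λ T n ≤ StarSubalgebra.centralizer ℂ
      {InnerProductSpace.rankOne ℂ (evec Λ v) (evec Λ w)} := by
  refine StarSubalgebra.topologicalClosure_minimal (StarAlgebra.adjoin_le ?_)
    (Set.isClosed_centralizer _)
  rintro _ ⟨ν, -, hν, rfl⟩
  classical
  have hsa := IsSelfAdjoint.star_mul_self (T ν)
  have hv := star_mul_self_evec hT1 hT2 ν v
  have hw := star_mul_self_evec hT1 hT2 ν w
  rw [SetLike.mem_coe, StarSubalgebra.mem_centralizer_iff ℂ]
  rintro _ rfl
  rw [ContinuousLinearMap.star_eq_adjoint (InnerProductSpace.rankOne ℂ _ _),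
    InnerProductSpace.adjoint_rankOne]
  exact ⟨(commute_rankOne_iff hsa hv hw).2 (h ν hν), (commute_rankOne_iff hsa hw hv).2 (h ν hν).symm⟩

/-- A factorial language `Λ*` is sofic (there is `m̄` such that `∼_n̄` equals `∼` for all
`n̄ ≥ m̄`) if and only if there exists `m̄ ∈ ℤ₊^N` with `A = A_n̄` for all `n̄ ≥ m̄`, where `A`
is the C*-algebra of checkers and `A_n̄` are its finite-stage subalgebras. -/
theorem sofic_iff_checkers_stabilize {d N : ℕ} (Λ : Set (MWord d N)) (hFL : IsFL Λ)
    (T : MWord d N → (ell2 Λ →L[ℂ] ell2 Λ))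
    (hT1 : ∀ (μ : MWord d N) (w : Λ) (h : μ * (w : MWord d N) ∈ Λ),
      T μ (evec Λ w) = evec Λ ⟨μ * (w : MWord d N), h⟩)
    (hT2 : ∀ (μ : MWord d N) (w : Λ), μ * (w : MWord d N) ∉ Λ → T μ (evec Λ w) = 0) :
    (∃ m : Fin N → ℕ, ∀ n : Fin N → ℕ, m ≤ n →
        ∀ μ ∈ Λ, ∀ ν ∈ Λ, (simRel Λ n μ ν ↔ simFull Λ μ ν)) ↔
    (∃ m : Fin N → ℕ, ∀ n : Fin N → ℕ, m ≤ n → checkers Λ T = checkersLe Λ T n) := by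
  classical
  constructor
  · rintro ⟨m, hm⟩
    refine ⟨m, fun n hn => le_antisymm ?_ ?_⟩
    · refine StarSubalgebra.topologicalClosure_mono (StarAlgebra.adjoin_le ?_)
      rintro _ ⟨μ, -, rfl⟩
      obtain ⟨Q, hQS, hQ⟩ := exists_diagonal_mem
        (StarAlgebra.adjoin ℂ {x : ell2 Λ →L[ℂ] ell2 Λ |
          ∃ μ : MWord d N, μ ∈ Λ ∧ mlen μ ≤ n ∧ x = star (T μ) * T μ})
        (F := {ν | mlen ν ≤ n ∧ ν ∈ Λ}) ((finite_setOf_mlen_le n).subset fun ν hν => hν.1)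
        (fun ν hν => ⟨_, StarAlgebra.subset_adjoin ℂ _ ⟨ν, hν.2, hν.1, rfl⟩,
          star_mul_self_evec hT1 hT2 ν⟩)
        (fun s => ∃ v : Λ, μ * (v : MWord d N) ∈ Λ ∧
          {ν | ν ∈ {ν | mlen ν ≤ n ∧ ν ∈ Λ} ∧ ν * (v : MWord d N) ∈ Λ} = s)
      suffices h : star (T μ) * T μ = Q from h ▸ hQS
      refine ext_evec fun w => ?_
      rw [star_mul_self_evec hT1 hT2, hQ]
      refine if_congr ⟨fun h => ⟨w, h, rfl⟩, ?_⟩ rfl rfl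
      rintro ⟨v, hv, hvw⟩
      refine ((hm n hn v v.2 w w.2).1 (fun ν hν => ?_) μ).1 hv
      have h := Set.ext_iff.1 hvw ν
      exact ⟨fun hνv => (h.1 ⟨⟨hν, hFL.left_mem hνv⟩, hνv⟩).2,
        fun hνw => (h.2 ⟨⟨hν, hFL.left_mem hνw⟩, hνw⟩).2⟩
    · refine StarSubalgebra.topologicalClosure_mono (StarAlgebra.adjoin_mono ?_)
      rintro _ ⟨μ, hμ, -, rfl⟩
      exact ⟨μ, hμ, rfl⟩
  · rintro ⟨m, hm⟩
    refine ⟨m, fun n hn μ hμ ν hν => ⟨fun h κ => ?_, fun h κ _ => h κ⟩⟩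
    by_cases hκ : κ ∈ Λ
    · have hmem : star (T κ) * T κ ∈ checkersLe Λ T n := by
        rw [← hm n hn]
        exact StarSubalgebra.le_topologicalClosure _
          (StarAlgebra.subset_adjoin ℂ _ ⟨κ, hκ, rfl⟩)
      have hc := (StarSubalgebra.mem_centralizer_iff ℂ).1
        (checkersLe_le_centralizer_rankOne hT1 hT2 (v := ⟨μ, hμ⟩) (w := ⟨ν, hν⟩)
          h hmem) _ rfl
      exact (commute_rankOne_iff (IsSelfAdjoint.star_mul_self (T κ))
        (star_mul_self_evec hT1 hT2 κ ⟨μ, hμ⟩) (star_mul_self_evec hT1 hT2 κ ⟨ν, hν⟩)).1 hc.1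
    · exact iff_of_false (fun h => hκ (hFL.left_mem h)) fun h => hκ (hFL.left_mem h)

end
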